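/- Let H = (V,E) be a hypergraph of dimension d ≥ 2 whose edge set is an antichain (no edge is properly contained in another), and mark each vertex independently with probability p = 1/(aΔ(H)) where a = 2^{d+1}. Let X ⊆ V be nonempty and let j ≥ 1 satisfy |X| + j ≤ d. If d_j(X,H) ≥ ε·Δ(H) for some ε with 0 < ε ≤ 1, then Pr[∃ Y ∈ N_j(X,H) such that A_Y] ≥ (1/4)·(ε/a)^j. -/

import Mathlib

open Finset

/-- The probability weight of a marking outcome `ω`, when each vertex is marked
independently with probability `p`. -/
noncomputable def markWeight {V : Type} [Fintype V] (p : ℝ) (ω : V → Bool) : ℝ :=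
  ∏ v, if ω v then p else 1 - p

open Classical in
/-- The probability of the event `A` under independent `Bernoulli(p)` marking of
the vertices. -/
noncomputable def markPr {V : Type} [Fintype V] (p : ℝ) (A : (V → Bool) → Prop) : ℝ :=
  ∑ ω : V → Bool, if A ω then markWeight p ω else 0

/-- `C_X`: every vertex of `X` is marked. -/
def Cev {V : Type} (X : Finset V) (ω : V → Bool) : Prop := ∀ v ∈ X, ω v = true

/-- `E_X`: some vertex of `X` belongs to a fully marked edge. -/
def Eev {V : Type} (E : Finset (Finset V)) (X : Finset V) (ω : V → Bool) : Prop :=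
  ∃ e ∈ E, (∃ v ∈ X, v ∈ e) ∧ ∀ v ∈ e, ω v = true

/-- `A_X = C_X ∧ ¬E_X`: all of `X` is marked and no vertex of `X` gets unmarked. -/
def Aev {V : Type} (E : Finset (Finset V)) (X : Finset V) (ω : V → Bool) : Prop :=
  Cev X ω ∧ ¬ Eev E X ω

/-- `N_j(x,H) = {y ⊆ V : x ∪ y ∈ E, x ∩ y = ∅, |y| = j}`. -/
def Nset {V : Type} [Fintype V] [DecidableEq V] (E : Finset (Finset V))
    (x : Finset V) (j : ℕ) : Finset (Finset V) :=
  Finset.univ.filter (fun y => x ∪ y ∈ E ∧ x ∩ y = ∅ ∧ y.card = j)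

/-- The normalized degree `d_j(x,H) = |N_j(x,H)|^(1/j)`. -/
noncomputable def dDeg {V : Type} [Fintype V] [DecidableEq V] (E : Finset (Finset V))
    (x : Finset V) (j : ℕ) : ℝ :=
  ((Nset E x j).card : ℝ) ^ (1 / (j : ℝ))

/-- `Δ_i(H) = max{d_{i−|x|}(x,H) : x ⊆ V, 0 < |x| < i}`. -/
noncomputable def DeltaI {V : Type} [Fintype V] [DecidableEq V] (E : Finset (Finset V))
    (i : ℕ) : ℝ :=
  sSup {r : ℝ | ∃ x : Finset V, 0 < x.card ∧ x.card < i ∧ r = dDeg E x (i - x.card)}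

/-- `Δ(H) = max{Δ_i(H) : 2 ≤ i ≤ d}`. -/
noncomputable def Delta {V : Type} [Fintype V] [DecidableEq V] (E : Finset (Finset V))
    (d : ℕ) : ℝ :=
  sSup {r : ℝ | ∃ i : ℕ, 2 ≤ i ∧ i ≤ d ∧ r = DeltaI E i}
section Marking

variable {V : Type} [Fintype V]

theorem markWeight_nonneg {p : ℝ} (hp0 : 0 ≤ p) (hp1 : p ≤ 1) (ω : V → Bool) :
    0 ≤ markWeight p ω := by
  refine Finset.prod_nonneg fun v _ => ?_
  split_ifs <;> linarith

open Classical in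
theorem markPr_Cev (p : ℝ) (X : Finset V) : markPr p (Cev X) = p ^ X.card := by
  have key : ∀ ω : V → Bool, (if Cev X ω then markWeight p ω else 0) =
      ∏ v, (if ω v then p else if v ∈ X then 0 else 1 - p) := by
    intro ω
    split_ifs with h
    · refine Finset.prod_congr rfl fun v _ => ?_
      by_cases hv : v ∈ X
      · simp [h v hv]
      · simp [hv]
    · simp only [Cev, not_forall] at h
      obtain ⟨v, hv, hω⟩ := h
      exact (Finset.prod_eq_zero (Finset.mem_univ v) (by simp [hv, hω])).symm
  have hprod := Finset.prod_univ_sum (fun _ : V => (Finset.univ : Finset Bool))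
    (fun v b => if b then p else if v ∈ X then 0 else 1 - p)
  rw [Fintype.piFinset_univ] at hprod
  rw [markPr, Finset.sum_congr rfl fun ω _ => key ω, ← hprod]
  have hv : ∀ v : V, (∑ b : Bool, if b then p else if v ∈ X then 0 else 1 - p) =
      if v ∈ X then p else 1 := by
    intro v
    split_ifs <;> simp
  rw [Finset.prod_congr rfl fun v _ => hv v]
  simp

open Classical in
theorem markPr_eq_sum [DecidableEq V] (p : ℝ) (A : (V → Bool) → Prop) :
    markPr p A = ∑ ω, markWeight p ω * (if A ω then (1 : ℝ) else 0) := by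
  rw [markPr]
  refine Finset.sum_congr (by ext; simp) fun ω _ => by split_ifs <;> simp

end Marking

section Degrees

variable {V : Type} [Fintype V] [DecidableEq V]

theorem mem_Nset {E : Finset (Finset V)} {x y : Finset V} {j : ℕ} :
    y ∈ Nset E x j ↔ x ∪ y ∈ E ∧ x ∩ y = ∅ ∧ y.card = j := by
  simp [Nset]

theorem dDeg_le_Delta (E : Finset (Finset V)) {d k : ℕ} {x : Finset V} (hx : x.Nonempty)
    (hk : 1 ≤ k) (hkd : x.card + k ≤ d) : dDeg E x k ≤ Delta E d := by
  have hx0 := hx.card_pos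
  have h1 : dDeg E x k ≤ DeltaI E (x.card + k) := by
    refine le_csSup ?_ ⟨x, hx0, by omega, by simp⟩
    refine (Set.finite_range fun y : Finset V =>
      dDeg E y (x.card + k - y.card)).bddAbove.mono ?_
    rintro r ⟨y, -, -, rfl⟩
    exact ⟨y, rfl⟩
  refine h1.trans (le_csSup ?_ ⟨x.card + k, by omega, hkd, rfl⟩)
  refine ((Set.finite_Icc 2 d).image (DeltaI E)).bddAbove.mono ?_
  rintro r ⟨i, h2, hi, rfl⟩
  exact ⟨i, ⟨h2, hi⟩, rfl⟩

theorem dDeg_nonneg (E : Finset (Finset V)) (x : Finset V) (k : ℕ) : 0 ≤ dDeg E x k :=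
  Real.rpow_nonneg (Nat.cast_nonneg _) _

theorem dDeg_pow (E : Finset (Finset V)) (x : Finset V) {k : ℕ} (hk : 1 ≤ k) :
    dDeg E x k ^ k = (Nset E x k).card := by
  rw [dDeg, one_div, Real.rpow_inv_natCast_pow (Nat.cast_nonneg _) (by omega)]

theorem card_Nset_le (E : Finset (Finset V)) {d k : ℕ} {x : Finset V} (hx : x.Nonempty)
    (hk : 1 ≤ k) (hkd : x.card + k ≤ d) : ((Nset E x k).card : ℝ) ≤ Delta E d ^ k := by
  rw [← dDeg_pow E x hk]
  exact pow_le_pow_left₀ (dDeg_nonneg E x k) (dDeg_le_Delta E hx hk hkd) k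

theorem one_le_Delta {E : Finset (Finset V)} {d : ℕ} (hd : 2 ≤ d)
    (h : ∃ e ∈ E, e.card = d) : 1 ≤ Delta E d := by
  obtain ⟨e, he, hcard⟩ := h
  obtain ⟨v, hv⟩ : e.Nonempty := Finset.card_pos.mp (by omega)
  refine le_trans ?_
    (dDeg_le_Delta E (Finset.singleton_nonempty v) (k := d - 1) (by omega) (by simp; omega))
  refine Real.one_le_rpow ?_ (by positivity)
  rw [Nat.one_le_cast, Nat.one_le_iff_ne_zero, ← Nat.pos_iff_ne_zero, Finset.card_pos]
  refine ⟨e.erase v, mem_Nset.mpr ⟨?_, by simp, by rw [Finset.card_erase_of_mem hv, hcard]⟩⟩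
  rwa [Finset.singleton_union, Finset.insert_erase hv]

theorem sum_pow_Icc_le {r : ℝ} (hr0 : 0 ≤ r) (hr : r ≤ 1 / 8) (m : ℕ) :
    ∑ k ∈ Finset.Icc 1 m, r ^ k ≤ 3 / 2 * r := by
  have h : ∑ k ∈ Finset.Icc 1 m, r ^ k ≤ 3 / 2 * r - 3 / 2 * r ^ (m + 1) := by
    induction m with
    | zero => simp
    | succ m ih =>
      rw [Finset.sum_Icc_succ_top (by omega)]
      have : 0 ≤ r ^ (m + 1) := by positivity
      have : r ^ (m + 1 + 1) = r ^ (m + 1) * r := pow_succ _ _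
      nlinarith
  have : 0 ≤ r ^ (m + 1) := by positivity
  linarith

/-- The edges properly containing a nonempty set `Z` have small total weight. -/
theorem sum_pow_ssupersets_le {E : Finset (Finset V)} {d : ℕ} (hdim : ∀ e ∈ E, e.card ≤ d)
    {p r : ℝ} (hp : 0 ≤ p) (hr : p * Delta E d = r) (hr0 : 0 ≤ r) (hr8 : r ≤ 1 / 8)
    {Z : Finset V} (hZ : Z.Nonempty) :
    ∑ e ∈ E with Z ⊂ e, p ^ (e \ Z).card ≤ 3 / 2 * r := by
  have hmaps : ∀ e ∈ E.filter (Z ⊂ ·), (e \ Z).card ∈ Finset.Icc 1 (d - Z.card) := by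
    intro e he
    obtain ⟨heE, hZe⟩ := Finset.mem_filter.mp he
    have h1 := Finset.card_lt_card hZe
    have h2 := hdim e heE
    rw [Finset.card_sdiff_of_subset hZe.subset, Finset.mem_Icc]
    omega
  rw [← Finset.sum_fiberwise_of_maps_to hmaps]
  refine le_trans (Finset.sum_le_sum fun k hk => ?_) (sum_pow_Icc_le hr0 hr8 (d - Z.card))
  obtain ⟨hk1, hkd⟩ := Finset.mem_Icc.mp hk
  set F := (E.filter (Z ⊂ ·)).filter (fun e => (e \ Z).card = k) with hF
  have hcard : F.card ≤ (Nset E Z k).card := by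
    refine Finset.card_le_card_of_injOn (· \ Z) ?_ ?_
    · intro e he
      simp only [hF, Finset.coe_filter, Finset.mem_filter, Set.mem_ofPred_eq] at he
      simp only [Finset.mem_coe, mem_Nset]
      refine ⟨?_, Finset.inter_sdiff_self _ _, he.2⟩
      rw [Finset.union_sdiff_of_subset he.1.2.subset]
      exact he.1.1
    · intro e he e' he' h
      simp only [hF, Finset.coe_filter, Finset.mem_filter, Set.mem_ofPred_eq] at he he'
      rw [← Finset.union_sdiff_of_subset he.1.2.subset,
        ← Finset.union_sdiff_of_subset he'.1.2.subset]
      exact congrArg (Z ∪ ·) h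
  have hcard' : (F.card : ℝ) ≤ Delta E d ^ k :=
    (Nat.cast_le.mpr hcard).trans (card_Nset_le E hZ hk1 (by omega))
  calc ∑ e ∈ F, p ^ (e \ Z).card = ∑ e ∈ F, p ^ k :=
        Finset.sum_congr rfl fun e he => by rw [(Finset.mem_filter.mp he).2]
    _ = F.card * p ^ k := by simp
    _ ≤ Delta E d ^ k * p ^ k := by gcongr
    _ = r ^ k := by rw [← mul_pow, mul_comm, hr]

/-- Union bound over edges, grouped by their traces on `W`. -/
theorem sum_pow_sdiff_le {E : Finset (Finset V)} {d : ℕ} (hdim : ∀ e ∈ E, e.card ≤ d)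
    {p r : ℝ} (hp : 0 ≤ p) (hr : p * Delta E d = r) (hr0 : 0 ≤ r) (hr8 : r ≤ 1 / 8)
    {W : Finset V} {F T : Finset (Finset V)} (hFE : F ⊆ E)
    (hFT : ∀ e ∈ F, e ∩ W ∈ T) (hFW : ∀ e ∈ F, (e ∩ W).Nonempty) (hF : ∀ e ∈ F, ¬ e ⊆ W) :
    ∑ e ∈ F, p ^ (e \ W).card ≤ T.card * (3 / 2 * r) := by
  rw [← Finset.sum_fiberwise_of_maps_to hFT, ← nsmul_eq_mul]
  refine Finset.sum_le_card_nsmul _ _ _ fun Z _ => ?_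
  rcases (F.filter (fun e => e ∩ W = Z)).eq_empty_or_nonempty with h | ⟨e₀, he₀⟩
  · rw [h, Finset.sum_empty]; positivity
  obtain ⟨he₀F, rfl⟩ := Finset.mem_filter.mp he₀
  refine le_trans ?_ (sum_pow_ssupersets_le hdim hp hr hr0 hr8 (hFW e₀ he₀F))
  refine le_trans (Finset.sum_le_sum fun e he => ?_)
    (Finset.sum_le_sum_of_subset_of_nonneg (s := F.filter (fun e => e ∩ W = e₀ ∩ W))
      ?_ fun _ _ _ => by positivity)
  · rw [← (Finset.mem_filter.mp he).2, Finset.sdiff_inter_self_left]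
  · intro e he
    obtain ⟨heF, heq⟩ := Finset.mem_filter.mp he
    refine Finset.mem_filter.mpr ⟨hFE heF, ?_⟩
    rw [← heq]
    refine Finset.ssubset_iff_subset_ne.mpr ⟨Finset.inter_subset_left, fun h => hF e heF ?_⟩
    exact Finset.inter_eq_left.mp h

theorem sum_pow_meeting_le {E : Finset (Finset V)} {d : ℕ} (hdim : ∀ e ∈ E, e.card ≤ d)
    (hanti : ∀ e ∈ E, ∀ e' ∈ E, e ⊆ e' → e = e')
    {p r : ℝ} (hp : 0 ≤ p) (hr : p * Delta E d = r) (hr0 : 0 ≤ r) (hr8 : r ≤ 1 / 8)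
    {X Y : Finset V} (hX : X.Nonempty) {j : ℕ} (hY : Y ∈ Nset E X j) :
    ∑ e ∈ E with (e ∩ Y).Nonempty, p ^ (e ∪ Y).card ≤ p ^ j * (2 ^ j * (3 / 2 * r)) := by
  obtain ⟨hXY, hdisj, hcard⟩ := mem_Nset.mp hY
  have h := sum_pow_sdiff_le hdim hp hr hr0 hr8 (W := Y) (T := Y.powerset)
    (Finset.filter_subset (fun e => (e ∩ Y).Nonempty) E)
    (fun e _ => Finset.mem_powerset.mpr Finset.inter_subset_right)
    (fun e he => (Finset.mem_filter.mp he).2)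
    (fun e he heY => by
      have := hanti e (Finset.mem_filter.mp he).1 _ hXY (heY.trans Finset.subset_union_right)
      obtain ⟨v, hv⟩ := hX
      have hvY : v ∈ Y := heY (this ▸ Finset.mem_union_left _ hv)
      have : v ∈ X ∩ Y := Finset.mem_inter.mpr ⟨hv, hvY⟩
      simp [hdisj] at this)
  rw [Finset.card_powerset, hcard] at h
  push_cast at h
  refine le_trans (le_of_eq ?_) (mul_le_mul_of_nonneg_left h (pow_nonneg hp j))
  rw [Finset.mul_sum]
  refine Finset.sum_congr rfl fun e _ => ?_
  rw [← pow_add, ← Finset.card_sdiff_add_card, hcard, add_comm]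

theorem sum_pow_pairs_le {E : Finset (Finset V)} {d : ℕ} (hdim : ∀ e ∈ E, e.card ≤ d)
    (hanti : ∀ e ∈ E, ∀ e' ∈ E, e ⊆ e' → e = e')
    {p r : ℝ} (hp : 0 ≤ p) (hr : p * Delta E d = r) (hr0 : 0 ≤ r) (hr8 : r ≤ 1 / 8)
    {X Y : Finset V} (hX : X.Nonempty) {j : ℕ} (hY : Y ∈ Nset E X j) :
    ∑ Y' ∈ (Nset E X j).erase Y, p ^ (Y' ∪ Y).card ≤ p ^ j * (2 ^ j * (3 / 2 * r)) := by
  obtain ⟨hXY, hdisj, hcard⟩ := mem_Nset.mp hY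
  have hrec : ∀ Y' ∈ Nset E X j, (X ∪ Y') \ X = Y' := by
    intro Y' hY'
    exact Finset.union_sdiff_cancel_left
      (Finset.disjoint_iff_inter_eq_empty.mpr (mem_Nset.mp hY').2.1)
  have hinj : Set.InjOn (X ∪ ·) ((Nset E X j).erase Y : Set (Finset V)) := by
    intro A hA B hB hAB
    have hA' := hrec A (Finset.mem_of_mem_erase hA)
    have hB' := hrec B (Finset.mem_of_mem_erase hB)
    rw [← hA', ← hB']
    exact congrArg (· \ X) hAB
  have hF : ∀ e ∈ ((Nset E X j).erase Y).image (X ∪ ·),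
      ∃ Y', Y' ≠ Y ∧ Y' ∈ Nset E X j ∧ X ∪ Y' = e := by
    intro e he
    obtain ⟨Y', hY', rfl⟩ := Finset.mem_image.mp he
    exact ⟨Y', (Finset.mem_erase.mp hY').1, (Finset.mem_erase.mp hY').2, rfl⟩
  have h := sum_pow_sdiff_le hdim hp hr hr0 hr8 (W := X ∪ Y)
    (F := ((Nset E X j).erase Y).image (X ∪ ·)) (T := Y.powerset.image (X ∪ ·))
    (fun e he => by
      obtain ⟨Y', -, hY', rfl⟩ := hF e he
      exact (mem_Nset.mp hY').1)
    (fun e he => by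
      obtain ⟨Y', -, -, rfl⟩ := hF e he
      exact Finset.mem_image.mpr ⟨Y' ∩ Y, Finset.mem_powerset.mpr Finset.inter_subset_right,
        Finset.union_inter_distrib_left _ _ _⟩)
    (fun e he => by
      obtain ⟨Y', -, -, rfl⟩ := hF e he
      exact hX.mono (Finset.subset_inter Finset.subset_union_left Finset.subset_union_left))
    (fun e he hsub => by
      obtain ⟨Y', hne, hY', rfl⟩ := hF e he
      have := hanti _ (mem_Nset.mp hY').1 _ hXY hsub
      apply hne
      rw [← hrec Y' hY', ← hrec Y hY, this])
  rw [Finset.sum_image hinj] at h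
  have hT : ((Y.powerset.image (X ∪ ·)).card : ℝ) ≤ 2 ^ j := by
    rw [← hcard]
    exact_mod_cast Finset.card_image_le.trans (Finset.card_powerset Y).le
  have h' := h.trans (mul_le_mul_of_nonneg_right hT (by positivity))
  refine le_trans (le_of_eq ?_) (mul_le_mul_of_nonneg_left h' (pow_nonneg hp j))
  rw [Finset.mul_sum]
  refine Finset.sum_congr rfl fun Y' hY' => ?_
  have hsd : (X ∪ Y') \ (X ∪ Y) = Y' \ Y := by
    exact sdiff_sdiff_left.symm.trans
      (congrArg (· \ Y) (hrec Y' (Finset.mem_of_mem_erase hY')))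
  rw [hsd, ← pow_add, ← Finset.card_sdiff_add_card, hcard, add_comm]

end Degrees

section Bonferroni

theorem Cev_union {V : Type} [DecidableEq V] {A B : Finset V} {ω : V → Bool} :
    Cev (A ∪ B) ω ↔ Cev A ω ∧ Cev B ω := by
  simp only [Cev, Finset.mem_union, or_imp, forall_and]

variable {V : Type} [Fintype V] [DecidableEq V]

open Classical in
theorem indicator_exists_Aev_ge (E N : Finset (Finset V)) (ω : V → Bool) :
    ∑ Y ∈ N, ((if Cev Y ω then (1 : ℝ) else 0)
        - ∑ e ∈ E with (e ∩ Y).Nonempty, (if Cev (e ∪ Y) ω then (1 : ℝ) else 0)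
        - ∑ Y' ∈ N.erase Y, (if Cev (Y' ∪ Y) ω then (1 : ℝ) else 0))
      ≤ if ∃ Y ∈ N, Aev E Y ω then 1 else 0 := by
  have hnn : ∀ (S : Finset (Finset V)) (Y : Finset V),
      0 ≤ ∑ e ∈ S, (if Cev (e ∪ Y) ω then (1 : ℝ) else 0) :=
    fun S Y => Finset.sum_nonneg fun e _ => by split_ifs <;> norm_num
  have hone : ∀ (S : Finset (Finset V)) (Y e : Finset V), e ∈ S → Cev (e ∪ Y) ω →
      1 ≤ ∑ e ∈ S, (if Cev (e ∪ Y) ω then (1 : ℝ) else 0) := by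
    intro S Y e he hC
    refine le_trans ?_ (Finset.single_le_sum
      (f := fun e => if Cev (e ∪ Y) ω then (1 : ℝ) else 0)
      (fun e _ => by split_ifs <;> norm_num) he)
    simp [hC]
  have hR : (0 : ℝ) ≤ if ∃ Y ∈ N, Aev E Y ω then 1 else 0 := by split_ifs <;> norm_num
  by_cases hbad : ∃ Y ∈ N, Aev E Y ω ∧ ∀ Y' ∈ N.erase Y, ¬ Cev Y' ω
  · obtain ⟨Y, hY, hA, hother⟩ := hbad
    rw [if_pos ⟨Y, hY, hA⟩, ← Finset.add_sum_erase _ _ hY]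
    have h1 := hnn (E.filter fun e => (e ∩ Y).Nonempty) Y
    have h2 := hnn (N.erase Y) Y
    have h3 : ∑ Z ∈ N.erase Y, ((if Cev Z ω then (1 : ℝ) else 0)
        - ∑ e ∈ E with (e ∩ Z).Nonempty, (if Cev (e ∪ Z) ω then (1 : ℝ) else 0)
        - ∑ Y' ∈ N.erase Z, (if Cev (Y' ∪ Z) ω then (1 : ℝ) else 0)) ≤ 0 := by
      refine Finset.sum_nonpos fun Z hZ => ?_
      rw [if_neg (hother Z hZ)]
      have h1 := hnn (E.filter fun e => (e ∩ Z).Nonempty) Z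
      have h2 := hnn (N.erase Z) Z
      linarith
    rw [if_pos hA.1]
    linarith
  · refine le_trans (Finset.sum_nonpos fun Y hY => ?_) hR
    have h1 := hnn (E.filter fun e => (e ∩ Y).Nonempty) Y
    have h2 := hnn (N.erase Y) Y
    by_cases hC : Cev Y ω
    · rw [if_pos hC]
      by_cases hE : Eev E Y ω
      · obtain ⟨e, he, ⟨v, hvY, hve⟩, hmark⟩ := hE
        have := hone (E.filter fun e => (e ∩ Y).Nonempty) Y e
          (Finset.mem_filter.mpr ⟨he, v, Finset.mem_inter.mpr ⟨hve, hvY⟩⟩)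
          (Cev_union.mpr ⟨hmark, hC⟩)
        linarith
      · have : ∃ Y' ∈ N.erase Y, Cev Y' ω := by
          by_contra! hno
          exact hbad ⟨Y, hY, ⟨hC, hE⟩, hno⟩
        obtain ⟨Y', hY', hC'⟩ := this
        have := hone (N.erase Y) Y Y' hY' (Cev_union.mpr ⟨hC', hC⟩)
        linarith
    · rw [if_neg hC]
      linarith

theorem markPr_exists_Aev_ge (E N : Finset (Finset V)) {p : ℝ} (hp0 : 0 ≤ p) (hp1 : p ≤ 1) :
    ∑ Y ∈ N, (p ^ Y.card - ∑ e ∈ E with (e ∩ Y).Nonempty, p ^ (e ∪ Y).card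
        - ∑ Y' ∈ N.erase Y, p ^ (Y' ∪ Y).card)
      ≤ markPr p (fun ω => ∃ Y ∈ N, Aev E Y ω) := by
  classical
  have hC : ∀ X : Finset V,
      p ^ X.card = ∑ ω, markWeight p ω * (if Cev X ω then (1 : ℝ) else 0) := by
    intro X
    rw [← markPr_Cev, markPr_eq_sum]
  have hsum : ∀ (S : Finset (Finset V)) (Y : Finset V), ∑ e ∈ S, p ^ (e ∪ Y).card =
      ∑ ω, markWeight p ω * ∑ e ∈ S, (if Cev (e ∪ Y) ω then (1 : ℝ) else 0) := by
    intro S Y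
    simp only [hC, Finset.mul_sum]
    exact Finset.sum_comm
  simp only [hsum]
  simp only [hC, ← Finset.sum_sub_distrib, ← mul_sub]
  rw [Finset.sum_comm, markPr_eq_sum]
  refine Finset.sum_le_sum fun ω _ => ?_
  rw [← Finset.mul_sum]
  refine mul_le_mul_of_nonneg_left ?_ (markWeight_nonneg hp0 hp1 ω)
  refine (indicator_exists_Aev_ge E N ω).trans (le_of_eq ?_)
  congr

end Bonferroni

/-- Lemma 2 in Beame–Luby: for a hypergraph `H` of dimension `d ≥ 2` whose
edge set is an antichain, with each vertex marked independently with probability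
`p = 1/(a·Δ(H))` where `a = 2^(d+1)`: if `X ⊆ V` is nonempty, `j ≥ 1`, `|X| + j ≤ d`, and
`d_j(X,H) ≥ ε·Δ(H)` with `0 < ε ≤ 1`, then
`Pr[∃ Y ∈ N_j(X,H), A_Y] ≥ (1/4)·(ε/a)^j`. -/
theorem stmt5 {V : Type} [Fintype V] [DecidableEq V]
    (E : Finset (Finset V)) (d : ℕ)
    (hEne : ∀ e ∈ E, e.Nonempty)
    (hd : 2 ≤ d)
    (hdim : (∀ e ∈ E, e.card ≤ d) ∧ ∃ e ∈ E, e.card = d)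
    (hanti : ∀ e ∈ E, ∀ e' ∈ E, e ⊆ e' → e = e')
    (X : Finset V) (hX : X.Nonempty)
    (j : ℕ) (hj : 1 ≤ j) (hXj : X.card + j ≤ d)
    (ε : ℝ) (hε0 : 0 < ε) (hε1 : ε ≤ 1)
    (hdeg : ε * Delta E d ≤ dDeg E X j) :
    (1 / 4) * (ε / 2 ^ (d + 1)) ^ j
      ≤ markPr (1 / (2 ^ (d + 1) * Delta E d))
          (fun ω => ∃ Y ∈ Nset E X j, Aev E Y ω) := by
  have hΔ := one_le_Delta hd hdim.2
  have hΔ0 : 0 < Delta E d := by linarith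
  set a : ℝ := 2 ^ (d + 1) with ha
  have ha8 : 8 ≤ a := by
    calc (8 : ℝ) = 2 ^ 3 := by norm_num
      _ ≤ a := pow_le_pow_right₀ (by norm_num) (by omega)
  have ha0 : 0 < a := by linarith
  set p : ℝ := 1 / (a * Delta E d) with hpdef
  have hp0 : 0 ≤ p := by positivity
  have hp1 : p ≤ 1 := by
    rw [hpdef, div_le_one (by positivity)]
    nlinarith
  have hr : p * Delta E d = 1 / a := by
    rw [hpdef]
    field_simp
  have hr0 : 0 ≤ 1 / a := by positivity
  have hr8 : 1 / a ≤ 1 / 8 := one_div_le_one_div_of_le (by norm_num) ha8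
  have hsmall : 2 ^ j * (3 / 2 * (1 / a)) ≤ (3 / 8 : ℝ) := by
    have hX1 := hX.card_pos
    have h4 : (2 : ℝ) ^ j * 4 ≤ a := by
      calc (2 : ℝ) ^ j * 4 = 2 ^ (j + 2) := by rw [pow_add]; norm_num
        _ ≤ a := pow_le_pow_right₀ (by norm_num) (by omega)
    have : (2 : ℝ) ^ j * (1 / a) ≤ 1 / 4 := by
      rw [mul_one_div, div_le_iff₀ ha0]
      linarith
    linarith
  have hpj : 0 ≤ p ^ j := pow_nonneg hp0 j
  refine le_trans ?_ (markPr_exists_Aev_ge E (Nset E X j) hp0 hp1)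
  have hterm : ∀ Y ∈ Nset E X j, p ^ j * (1 / 4) ≤
      p ^ Y.card - ∑ e ∈ E with (e ∩ Y).Nonempty, p ^ (e ∪ Y).card
        - ∑ Y' ∈ (Nset E X j).erase Y, p ^ (Y' ∪ Y).card := by
    intro Y hY
    have h1 := sum_pow_meeting_le hdim.1 hanti hp0 hr hr0 hr8 hX hY
    have h2 := sum_pow_pairs_le hdim.1 hanti hp0 hr hr0 hr8 hX hY
    have h3 := mul_le_mul_of_nonneg_left hsmall hpj
    rw [(mem_Nset.mp hY).2.2]
    linarith
  refine le_trans ?_ (Finset.card_nsmul_le_sum _ _ _ hterm)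
  have hN : (ε * Delta E d) ^ j ≤ ((Nset E X j).card : ℝ) := by
    rw [← dDeg_pow E X hj]
    exact pow_le_pow_left₀ (by positivity) hdeg j
  have heq : (ε / a) ^ j = (ε * Delta E d) ^ j * p ^ j := by
    rw [← mul_pow, mul_assoc, mul_comm _ p, hr, mul_one_div]
  rw [nsmul_eq_mul, heq]
  have := mul_le_mul_of_nonneg_right hN hpj
  linarith
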